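/- Let R be a finite local ring with identity, with |R| = q^n, whose residue field R/J has q elements, where J = J(R) is the Jacobson radical. Then P_0(R) = (q^{n−1} + 2q − 2)/q^{n+1} if and only if J² = 0. -/

import Mathlib

/-- The multiplication probability of a finite ring `R` at `x`:
`P_x(R) = |{(a,b) ∈ R × R : a*b = x}| / |R|²`. -/
noncomputable def mulProb (R : Type*) [Ring R] (x : R) : ℚ :=
  (Nat.card {p : R × R // p.1 * p.2 = x} : ℚ) / (Nat.card R : ℚ) ^ 2

/-- The Jacobson radical of a ring, as a two-sided ideal. -/
abbrev jacobsonRadical (R : Type*) [Ring R] : TwoSidedIdeal R :=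
  (⊥ : TwoSidedIdeal R).jacobson

/-- The residue ring `R/J(R)` of a ring modulo its Jacobson radical. -/
abbrev residueRing (R : Type*) [Ring R] : Type _ :=
  (jacobsonRadical R).ringCon.Quotient

open Pointwise in
/-- Powers of a two-sided ideal, as additive submonoids of `R`: `J⁰ = R`, `J¹ = J`, and
`J^(k+1) = J · J^k` (the product ideal). -/
def idealPow {R : Type*} [Ring R] (J : TwoSidedIdeal R) : ℕ → AddSubmonoid R
  | 0 => ⊤
  | 1 => J.asIdeal.toAddSubmonoid
  | (k + 2) => J.asIdeal.toAddSubmonoid * idealPow J (k + 1)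

lemma aux_mem_jac {R : Type*} [Ring R] [Finite R] [IsLocalRing R] (x : R) :
    x ∈ jacobsonRadical R ↔ ¬ IsUnit x := by
  rw [TwoSidedIdeal.mem_jacobson_iff]
  constructor
  · rintro h ⟨u, rfl⟩
    obtain ⟨z, hz⟩ := h (-(↑u⁻¹ : R))
    have hz' : z * -(↑u⁻¹ : R) * u + z - 1 = 0 := hz
    rw [mul_assoc, neg_mul, Units.inv_mul] at hz'
    simp at hz'
  · intro hx y
    have h1 : ¬ IsUnit (-(y * x)) := by
      intro h
      rw [IsUnit.neg_iff] at h
      obtain ⟨u, hu⟩ := h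
      apply hx
      refine IsUnit.of_mul_eq_one_right ((↑u⁻¹ : R) * y) ?_
      rw [mul_assoc, ← hu, Units.inv_mul]
    have h2 : IsUnit (y * x + 1) :=
      (IsLocalRing.isUnit_or_isUnit_of_add_one
        (show -(y * x) + (y * x + 1) = 1 by abel)).resolve_left h1
    obtain ⟨u, hu⟩ := h2
    refine ⟨(↑u⁻¹ : R), ?_⟩
    have : (↑u⁻¹ : R) * y * x + (↑u⁻¹ : R) - 1 = 0 := by
      rw [mul_assoc, ← mul_add_one, ← hu, Units.inv_mul, sub_self]
    rw [this]
    exact TwoSidedIdeal.zero_mem _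

lemma aux_card_jac {R : Type*} [Ring R] [Finite R] :
    Nat.card (residueRing R) * Nat.card {x : R // x ∈ jacobsonRadical R} = Nat.card R := by
  let f : R →+ residueRing R := (jacobsonRadical R).ringCon.mk'.toAddMonoidHom
  have hf : Function.Surjective f := (jacobsonRadical R).ringCon.mk'_surjective
  have h := AddSubgroup.index_mul_card f.ker
  rw [AddSubgroup.index_ker, AddMonoidHom.range_eq_top.2 hf] at h
  rw [← h, AddSubgroup.card_top]
  congr 1
  apply Nat.card_congr
  refine Equiv.subtypeEquivRight fun x => ?_
  rw [AddMonoidHom.mem_ker]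
  have h2 : x ∈ TwoSidedIdeal.ker (jacobsonRadical R).ringCon.mk' ↔ f x = 0 :=
    TwoSidedIdeal.mem_ker _
  rwa [TwoSidedIdeal.ker_ringCon_mk'] at h2

open Pointwise in
lemma aux_sq {R : Type*} [Ring R] [Finite R] [IsLocalRing R] :
    idealPow (jacobsonRadical R) 2 = ⊥ ↔
      ∀ a b : R, ¬ IsUnit a → ¬ IsUnit b → a * b = 0 := by
  rw [eq_bot_iff]
  change (jacobsonRadical R).asIdeal.toAddSubmonoid *
    (jacobsonRadical R).asIdeal.toAddSubmonoid ≤ ⊥ ↔ _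
  rw [AddSubmonoid.mul_le]
  simp only [Submodule.mem_toAddSubmonoid, TwoSidedIdeal.mem_asIdeal, aux_mem_jac,
    AddSubmonoid.mem_bot]
  exact ⟨fun h a b ha hb => h a ha b hb, fun h a ha b hb => h a b ha hb⟩

open Classical in
lemma aux_count {R : Type*} [Ring R] [Fintype R] [Nontrivial R] :
    (Finset.univ.filter fun p : R × R => p.1 * p.2 = 0).card =
      (((Finset.univ.filter fun x : R => ¬ IsUnit x) ×ˢ
        (Finset.univ.filter fun x : R => ¬ IsUnit x)).filter fun p => p.1 * p.2 = 0).card +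
      2 * (Finset.univ.filter fun x : R => IsUnit x).card := by
  have e : (Finset.univ.filter fun p : R × R => p.1 * p.2 = 0) =
      ((((Finset.univ.filter fun x : R => ¬ IsUnit x) ×ˢ
        (Finset.univ.filter fun x : R => ¬ IsUnit x)).filter fun p => p.1 * p.2 = 0) ∪
      ((Finset.univ.filter fun x : R => IsUnit x) ×ˢ {0})) ∪
      ({0} ×ˢ (Finset.univ.filter fun x : R => IsUnit x)) := by
    ext ⟨a, b⟩
    simp only [Finset.mem_filter, Finset.mem_univ, true_and, Finset.mem_union,
      Finset.mem_product, Finset.mem_singleton]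
    constructor
    · intro h
      by_cases ha : IsUnit a
      · exact Or.inl (Or.inr ⟨ha, ha.mul_right_eq_zero.1 h⟩)
      · by_cases hb : IsUnit b
        · exact Or.inr ⟨hb.mul_left_eq_zero.1 h, hb⟩
        · exact Or.inl (Or.inl ⟨⟨ha, hb⟩, h⟩)
    · rintro ((⟨_, h⟩ | ⟨_, rfl⟩) | ⟨rfl, _⟩) <;> simp_all
  rw [e, Finset.card_union_of_disjoint, Finset.card_union_of_disjoint]
  · simp; ring
  · rw [Finset.disjoint_left]
    rintro ⟨a, b⟩ h1 h2
    simp only [Finset.mem_filter, Finset.mem_univ, true_and,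
      Finset.mem_product, Finset.mem_singleton] at h1 h2
    exact h1.1.1 h2.1
  · rw [Finset.disjoint_left]
    rintro ⟨a, b⟩ h1 h2
    simp only [Finset.mem_filter, Finset.mem_univ, true_and, Finset.mem_union,
      Finset.mem_product, Finset.mem_singleton] at h1 h2
    rcases h1 with h1 | h1
    · exact h1.1.2 h2.2
    · exact not_isUnit_zero (h1.2 ▸ h2.2)

/-- Let `R` be a finite local ring with `|R| = qⁿ` whose residue field `R/J`
has `q` elements. Then `P_0(R) = (q^{n−1} + 2q − 2)/q^{n+1}` if and only if `J² = 0`. -/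
theorem mulProb_zero_eq_iff_radical_sq_eq_zero
    {R : Type*} [Ring R] [Finite R] [IsLocalRing R] {q n : ℕ}
    (hcard : Nat.card R = q ^ n) (hres : Nat.card (residueRing R) = q) :
    mulProb R 0 = ((q : ℚ) ^ (n - 1) + 2 * (q : ℚ) - 2) / (q : ℚ) ^ (n + 1) ↔
      idealPow (jacobsonRadical R) 2 = ⊥ := by
  classical
  haveI := Fintype.ofFinite R
  rw [aux_sq]
  have hJ := aux_card_jac (R := R)
  rw [hres, hcard] at hJ
  set N : Finset R := Finset.univ.filter fun x : R => ¬ IsUnit x with hN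
  set U : Finset R := Finset.univ.filter fun x : R => IsUnit x with hU
  have hJN : Nat.card {x : R // x ∈ jacobsonRadical R} = N.card := by
    simp only [aux_mem_jac]
    rw [Nat.card_eq_fintype_card, Fintype.card_subtype]
  rw [hJN] at hJ
  have hUN : U.card + N.card = q ^ n := by
    rw [hU, hN, Finset.card_filter_add_card_filter_not, Finset.card_univ,
      ← Nat.card_eq_fintype_card, hcard]
  have hZ : Nat.card {p : R × R // p.1 * p.2 = 0} =
      ((N ×ˢ N).filter fun p => p.1 * p.2 = 0).card + 2 * U.card := by
    rw [Nat.card_eq_fintype_card, Fintype.card_subtype]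
    exact aux_count
  have hn : n ≠ 0 := by
    rintro rfl
    have := Finite.one_lt_card (α := R)
    rw [hcard] at this
    simp at this
  obtain ⟨k, rfl⟩ := Nat.exists_eq_succ_of_ne_zero hn
  have hq : 0 < q := by
    rcases Nat.eq_zero_or_pos q with h | h
    · have := Nat.card_pos (α := R)
      rw [hcard, h] at this
      simp at this
    · exact h
  have hNc : N.card = q ^ k := by
    apply Nat.eq_of_mul_eq_mul_left hq
    rw [hJ, pow_succ, mul_comm]
  have hiff : (∀ a b : R, ¬ IsUnit a → ¬ IsUnit b → a * b = 0) ↔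
      ((N ×ˢ N).filter fun p => p.1 * p.2 = 0).card = q ^ k * q ^ k := by
    rw [← hNc, ← Finset.card_product, Finset.card_filter_eq_iff]
    simp only [hN, Finset.mem_product, Finset.mem_filter, Finset.mem_univ, true_and, Prod.forall]
    exact ⟨fun h a b hab => h a b hab.1 hab.2, fun h a b ha hb => h a b ⟨ha, hb⟩⟩
  rw [hiff]
  unfold mulProb
  rw [hZ, hcard]
  generalize ((N ×ˢ N).filter fun p => p.1 * p.2 = 0).card = c
  rw [hNc] at hUN
  have hU2 : (U.card : ℚ) = (q : ℚ) ^ (k + 1) - (q : ℚ) ^ k := by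
    rw [eq_sub_iff_add_eq]; exact_mod_cast hUN
  have hq0 : (q : ℚ) ≠ 0 := by positivity
  rw [← Nat.cast_inj (R := ℚ)]
  push_cast
  rw [hU2, div_eq_div_iff (by positivity) (by positivity)]
  have e2 : ((q : ℚ) ^ k + 2 * q - 2) * ((q : ℚ) ^ k.succ) ^ 2 =
      ((q : ℚ) ^ k * q ^ k + 2 * (q ^ (k + 1) - q ^ k)) * q ^ (k.succ + 1) := by
    simp only [Nat.succ_eq_add_one]; ring
  rw [e2, mul_left_inj' (by positivity), add_left_inj]
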